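/- Let n ∈ ℕ, m ≥ 1 an integer, and f, g : 𝔽₂ⁿ → 𝔽₂. Then for every z ∈ 𝔽₂ⁿ, the m-crosscorrelation satisfies C^(m)_{f,g}(z) = ζ_m^(wt(z)) · ∑_{u ∈ 𝔽₂ⁿ} H^(m)_f(u) · conj(H^(m)_g(u)) · (-1)^(u·z). -/

import Mathlib

open Finset

noncomputable section

/-- Sign character: `(-1)^v ∈ ℂ` for `v ∈ 𝔽₂`. -/
def sgn (v : ZMod 2) : ℂ := if v = 0 then 1 else -1

/-- Hamming weight of `x ∈ 𝔽₂ⁿ`. -/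
def wt {n : ℕ} (x : Fin n → ZMod 2) : ℕ := (Finset.univ.filter (fun i => x i = 1)).card

/-- Dot product `x·y = ⊕ᵢ xᵢyᵢ ∈ 𝔽₂`. -/
def dotp {n : ℕ} (x y : Fin n → ZMod 2) : ZMod 2 := ∑ i, x i * y i

/-- `x⊙y ∈ ℕ`: number of indices with `xᵢ = yᵢ = 1`. -/
def odot {n : ℕ} (x y : Fin n → ZMod 2) : ℕ :=
  (Finset.univ.filter (fun i => x i = 1 ∧ y i = 1)).card

/-- `ζ_m = exp(2πi/m)`. -/
def zeta (m : ℕ) : ℂ := Complex.exp (2 * Real.pi * Complex.I / m)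

/-- The `m`-Hadamard transform of `f` at `ω`. -/
def mHad (m : ℕ) {n : ℕ} (f : (Fin n → ZMod 2) → ZMod 2) (ω : Fin n → ZMod 2) : ℂ :=
  ((Real.sqrt 2 : ℂ) ^ n)⁻¹ *
    ∑ x : Fin n → ZMod 2, sgn (f x + dotp x ω) * zeta m ^ wt x

/-- The `m`-crosscorrelation of `f` and `g` at `y`. -/
def mCross (m : ℕ) {n : ℕ} (f g : (Fin n → ZMod 2) → ZMod 2) (y : Fin n → ZMod 2) : ℂ :=
  ∑ x : Fin n → ZMod 2, sgn (f x + g (x + y)) * (zeta m ^ 2) ^ odot x y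

/-- The (3-fold) `m`-Forrelation of `f₁, f₂, f₃`. -/
def mForr (m : ℕ) {n : ℕ} (f₁ f₂ f₃ : (Fin n → ZMod 2) → ZMod 2) : ℂ :=
  ((2 : ℂ) ^ n)⁻¹ *
    ∑ x : Fin n → ZMod 2, sgn (f₁ x) * mHad m f₂ x * (starRingEnd ℂ) (mHad m f₃ x)

/-- The Walsh–Hadamard transform of `f` at `ω`. -/
def walsh {n : ℕ} (f : (Fin n → ZMod 2) → ZMod 2) (ω : Fin n → ZMod 2) : ℂ :=
  ((Real.sqrt 2 : ℂ) ^ n)⁻¹ * ∑ x : Fin n → ZMod 2, sgn (f x + dotp x ω)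

/-- The nega-Hadamard transform of `f` at `ω`. -/
def negaHad {n : ℕ} (f : (Fin n → ZMod 2) → ZMod 2) (ω : Fin n → ZMod 2) : ℂ :=
  ((Real.sqrt 2 : ℂ) ^ n)⁻¹ *
    ∑ x : Fin n → ZMod 2, sgn (f x + dotp x ω) * Complex.I ^ wt x

/-- The elementary symmetric quadratic Boolean function `s₂`. -/
def s2 {n : ℕ} (x : Fin n → ZMod 2) : ZMod 2 :=
  ∑ i : Fin n, ∑ j ∈ Finset.univ.filter (fun j => i < j), x i * x j

/-- The linear function `L_u(x) = ⊕ᵢ xᵢ · (⊕_{j ≠ i} uⱼ)`. -/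
def Lfun {n : ℕ} (u x : Fin n → ZMod 2) : ZMod 2 :=
  ∑ i : Fin n, x i * ∑ j ∈ Finset.univ.filter (fun j => j ≠ i), u j

end

theorem sgn_add (a b : ZMod 2) : sgn (a + b) = sgn a * sgn b := by
  have h : ∀ a b : ZMod 2, (a = 0 ∧ b = 0 ∧ a + b = 0) ∨ (a = 0 ∧ b ≠ 0 ∧ a + b ≠ 0) ∨
      (a ≠ 0 ∧ b = 0 ∧ a + b ≠ 0) ∨ (a ≠ 0 ∧ b ≠ 0 ∧ a + b = 0) := by decide
  unfold sgn
  rcases h a b with ⟨h1, h2, h3⟩ | ⟨h1, h2, h3⟩ | ⟨h1, h2, h3⟩ | ⟨h1, h2, h3⟩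
  · rw [if_pos h1, if_pos h2, if_pos h3]; norm_num
  · rw [if_pos h1, if_neg h2, if_neg h3]; norm_num
  · rw [if_neg h1, if_pos h2, if_neg h3]; norm_num
  · rw [if_neg h1, if_neg h2, if_pos h3]; norm_num

theorem sgn_zero : sgn 0 = 1 := by simp [sgn]

theorem conj_sgn (a : ZMod 2) : (starRingEnd ℂ) (sgn a) = sgn a := by
  unfold sgn; split_ifs <;> simp

theorem sgn_sum {ι : Type*} (s : Finset ι) (v : ι → ZMod 2) :
    sgn (∑ i ∈ s, v i) = ∏ i ∈ s, sgn (v i) := by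
  classical
  induction s using Finset.induction_on with
  | empty => simp [sgn_zero]
  | insert a s ha ih => rw [Finset.sum_insert ha, Finset.prod_insert ha, sgn_add, ih]

theorem sum_sgn_mul (a : ZMod 2) : ∑ t : ZMod 2, sgn (a * t) = if a = 0 then 2 else 0 := by
  have h : ∀ a : ZMod 2, a = 0 ∨ a = 1 := by decide
  have e : ∀ F : ZMod 2 → ℂ, ∑ t : ZMod 2, F t = F 0 + F 1 := fun F => Fin.sum_univ_two F
  rw [e]
  rcases h a with rfl | rfl
  · simp [sgn]; norm_num
  · simp [sgn]

theorem sum_sgn_dotp {n : ℕ} (w : Fin n → ZMod 2) :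
    ∑ u : Fin n → ZMod 2, sgn (dotp w u) = if w = 0 then (2 : ℂ) ^ n else 0 := by
  have h : ∑ u : Fin n → ZMod 2, sgn (dotp w u) = ∏ i, ∑ t : ZMod 2, sgn (w i * t) := by
    rw [Finset.prod_univ_sum, Fintype.piFinset_univ]
    exact Finset.sum_congr rfl fun u _ => sgn_sum _ _
  rw [h]
  simp_rw [sum_sgn_mul]
  split_ifs with hw
  · subst hw; simp
  · obtain ⟨i, hi⟩ := Function.ne_iff.mp hw
    exact Finset.prod_eq_zero (Finset.mem_univ i) (if_neg hi)

theorem wt_add {n : ℕ} (x z : Fin n → ZMod 2) :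
    wt z + wt x = wt (x + z) + 2 * odot x z := by
  unfold wt odot
  simp only [Finset.card_filter, Finset.mul_sum, ← Finset.sum_add_distrib]
  refine Finset.sum_congr rfl fun i _ => ?_
  have h : ∀ a b : ZMod 2, ((if b = 1 then 1 else 0) + (if a = 1 then 1 else 0) : ℕ)
      = (if a + b = 1 then 1 else 0) + 2 * (if a = 1 ∧ b = 1 then 1 else 0) := by decide
  exact h _ _

theorem zeta_conj (m : ℕ) : zeta m * (starRingEnd ℂ) (zeta m) = 1 := by
  unfold zeta
  rw [← Complex.exp_conj, ← Complex.exp_add, Complex.exp_eq_one_iff]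
  refine ⟨0, ?_⟩
  have h2 : (starRingEnd ℂ) 2 = 2 := Complex.conj_ofNat 2
  simp [h2]
  ring

theorem dotp_add_left {n : ℕ} (x y u : Fin n → ZMod 2) :
    dotp (x + y) u = dotp x u + dotp y u := by
  simp [dotp, add_mul, Finset.sum_add_distrib]

theorem dotp_comm {n : ℕ} (x y : Fin n → ZMod 2) : dotp x y = dotp y x := by
  simp [dotp, mul_comm]

theorem stmt0 (n m : ℕ) (hm : 1 ≤ m) (f g : (Fin n → ZMod 2) → ZMod 2)
    (z : Fin n → ZMod 2) :
    mCross m f g z =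
      zeta m ^ wt z *
        ∑ u : Fin n → ZMod 2,
          mHad m f u * (starRingEnd ℂ) (mHad m g u) * sgn (dotp u z) := by
  have hc : ((Real.sqrt 2 : ℂ) ^ n)⁻¹ * ((Real.sqrt 2 : ℂ) ^ n)⁻¹ * (2 : ℂ) ^ n = 1 := by
    have h2 : (Real.sqrt 2 : ℂ) * (Real.sqrt 2 : ℂ) = 2 := by
      rw [← Complex.ofReal_mul, Real.mul_self_sqrt (by norm_num)]; norm_num
    rw [← mul_inv, ← mul_pow, h2]
    exact inv_mul_cancel₀ (pow_ne_zero n two_ne_zero)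
  set c : ℂ := ((Real.sqrt 2 : ℂ) ^ n)⁻¹ with hcdef
  have hcc : (starRingEnd ℂ) c = c := by simp [hcdef]
  have key : ∀ u : Fin n → ZMod 2,
      mHad m f u * (starRingEnd ℂ) (mHad m g u) * sgn (dotp u z) =
      ∑ x : Fin n → ZMod 2, ∑ y : Fin n → ZMod 2,
        (c * c * (sgn (f x) * sgn (g y) * zeta m ^ wt x * (starRingEnd ℂ) (zeta m) ^ wt y)) *
          sgn (dotp (x + z + y) u) := by
    intro u
    unfold mHad
    rw [← hcdef]
    simp only [map_mul, map_sum, map_pow, hcc, conj_sgn]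
    rw [mul_mul_mul_comm, Finset.sum_mul_sum, Finset.mul_sum, Finset.sum_mul]
    refine Finset.sum_congr rfl fun x _ => ?_
    rw [Finset.mul_sum, Finset.sum_mul]
    refine Finset.sum_congr rfl fun y _ => ?_
    rw [dotp_add_left, dotp_add_left, dotp_comm z u]
    simp only [sgn_add]
    ring
  simp_rw [key]
  rw [Finset.sum_comm, Finset.mul_sum]
  unfold mCross
  refine Finset.sum_congr rfl fun x _ => ?_
  rw [Finset.sum_comm]
  simp_rw [← Finset.mul_sum, sum_sgn_dotp]
  have h0 : ∀ a b : ZMod 2, a + b = 0 ↔ b = a := by decide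
  have hy : ∀ y : Fin n → ZMod 2, (x + z + y = 0) ↔ y = x + z := by
    intro y
    simp only [funext_iff]
    exact forall_congr' fun i => h0 _ _
  simp_rw [hy, mul_ite, mul_zero]
  rw [Finset.sum_ite_eq' Finset.univ (x + z), if_pos (Finset.mem_univ _), sgn_add]
  have hz : zeta m ^ wt z * zeta m ^ wt x * (starRingEnd ℂ) (zeta m) ^ wt (x + z)
      = (zeta m ^ 2) ^ odot x z := by
    rw [← pow_add, wt_add, pow_add, mul_right_comm, ← mul_pow, zeta_conj, one_pow, one_mul,
      pow_mul]
  rw [← hz]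
  linear_combination (-(sgn (f x) * sgn (g (x + z)) * (zeta m ^ wt z * zeta m ^ wt x *
    (starRingEnd ℂ) (zeta m) ^ wt (x + z)))) * hc
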